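/- Let N ⊆ A[c_T] be the ideal generated by: (1) Σ_{i∈T} u_i c_{T∖{i}} for all T with |T| ≥ 3 (with convention c_{{i}} = u_i... interpreted via c-variables only for |T|≥2 and c_{{j}} replaced by u_j when needed); (2) c_{{i,j}}^2 + u_i^2 v_j^2 + u_j^2 v_i^2 for all pairs i ≠ j; (3) c_T c_U + Σ_{p∈T} (∏_{q∈T∩U∖{p}} v_q^2) u_p c_{(T∖{p}) Δ U} for T ≠ U when both have cardinality 2. Then the A-algebra homomorphism A[c_T]/N → B = ker(s) sending c_T ↦ s(v_T) is an isomorphism. -/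

import Mathlib

open MvPolynomial

set_option synthInstance.maxHeartbeats 1000000
set_option maxHeartbeats 1000000

/-- The derivation `s = Σ uᵢ ∂/∂vᵢ` on `C = (ℤ/2)[u₁,…,uₙ,v₁,…,vₙ]`,
determined by `s(uᵢ) = 0` and `s(vᵢ) = uᵢ`.  Here the variable `Sum.inl i`
is `uᵢ` and `Sum.inr i` is `vᵢ`. -/
noncomputable def sDer (n : ℕ) :
    Derivation (ZMod 2) (MvPolynomial (Fin n ⊕ Fin n) (ZMod 2))
      (MvPolynomial (Fin n ⊕ Fin n) (ZMod 2)) :=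
  MvPolynomial.mkDerivation (ZMod 2)
    (Sum.elim (fun _ => 0) (fun i => X (Sum.inl i)))


/-- The subring `A = k[u₁,…,uₙ,v₁²,…,vₙ²]` of `C`. -/
noncomputable def Asub (n : ℕ) : Subalgebra (ZMod 2) (MvPolynomial (Fin n ⊕ Fin n) (ZMod 2)) :=
  Algebra.adjoin (ZMod 2)
    (Set.range (fun i : Fin n => X (Sum.inl i)) ∪
      Set.range (fun i : Fin n => (X (Sum.inr i) : MvPolynomial (Fin n ⊕ Fin n) (ZMod 2)) ^ 2))

/-- `uᵢ` as an element of `A`. -/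
noncomputable def uA (n : ℕ) (i : Fin n) : Asub n :=
  ⟨X (Sum.inl i), Algebra.subset_adjoin (Set.mem_union_left _ ⟨i, rfl⟩)⟩

/-- `vᵢ²` as an element of `A`. -/
noncomputable def v2A (n : ℕ) (i : Fin n) : Asub n :=
  ⟨(X (Sum.inr i)) ^ 2, Algebra.subset_adjoin (Set.mem_union_right _ ⟨i, rfl⟩)⟩

/-- The index set of the variables `c_T`: subsets `T ⊆ {1,…,n}` with `|T| ≥ 2`. -/
abbrev cIdx (n : ℕ) := {T : Finset (Fin n) // 2 ≤ T.card}

/-- `c_S` for an arbitrary subset `S`, with the conventions `c_S = X_S` for `|S| ≥ 2`,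
`c_{{j}} = u_j` and `c_∅ = 0` (uniformly: `Σ_{j∈S} u_j` when `|S| ≤ 1`). -/
noncomputable def cOf (n : ℕ) (S : Finset (Fin n)) : MvPolynomial (cIdx n) (Asub n) :=
  if h : 2 ≤ S.card then X ⟨S, h⟩ else C (∑ j ∈ S, uA n j)

/-- The ideal `N ⊆ A[c_T]` generated by the relations (1), (2), (3). -/
noncomputable def Nideal (n : ℕ) : Ideal (MvPolynomial (cIdx n) (Asub n)) :=
  Ideal.span
    ({p | ∃ T : Finset (Fin n), 3 ≤ T.card ∧
        p = ∑ i ∈ T, C (uA n i) * cOf n (T.erase i)} ∪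
     {p | ∃ i j : Fin n, i ≠ j ∧
        p = (cOf n {i, j}) ^ 2 + C ((uA n i) ^ 2 * v2A n j + (uA n j) ^ 2 * v2A n i)} ∪
     {p | ∃ T U : Finset (Fin n), 2 ≤ T.card ∧ 2 ≤ U.card ∧
        (T.card = 2 → U.card = 2 → T ≠ U) ∧
        p = cOf n T * cOf n U + ∑ q ∈ T,
          C (uA n q * ∏ r ∈ (T ∩ U).erase q, v2A n r) * cOf n (symmDiff (T.erase q) U)})

/-- The `A`-algebra map `A[c_T] → C`, `c_T ↦ s(v_T)`. -/
noncomputable def phiMap (n : ℕ) :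
    MvPolynomial (cIdx n) (Asub n) →ₐ[Asub n] MvPolynomial (Fin n ⊕ Fin n) (ZMod 2) :=
  aeval (fun T : cIdx n => sDer n (∏ i ∈ T.1, X (Sum.inr i)))

section KoszulHomotopy

variable {n : ℕ}

@[simp] theorem sDer_inl (i : Fin n) : sDer n (X (Sum.inl i)) = 0 := by
  simp [sDer, mkDerivation_X]

@[simp] theorem sDer_inr (i : Fin n) : sDer n (X (Sum.inr i)) = X (Sum.inl i) := by
  simp [sDer, mkDerivation_X]

theorem sDer_sDer (c : MvPolynomial (Fin n ⊕ Fin n) (ZMod 2)) : sDer n (sDer n c) = 0 := by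
  induction c using MvPolynomial.induction_on with
  | C a => simp [← MvPolynomial.algebraMap_eq]
  | add p q hp hq => simp [hp, hq]
  | mul_X p i hp =>
    rcases i with i | i
    · simp [hp]
    · simp only [Derivation.leibniz, sDer_inr, map_add, smul_eq_mul, hp, sDer_inl]
      have := CharTwo.add_self_eq_zero (X (Sum.inl i) * sDer n p)
      linear_combination this

/-- Replace one factor `vⱼ` of the monomial with exponent `m` by `uⱼ`. -/
noncomputable def lowerExp (j : Fin n) (m : Fin n ⊕ Fin n →₀ ℕ) : Fin n ⊕ Fin n →₀ ℕ :=
  m - Finsupp.single (Sum.inr j) 1 + Finsupp.single (Sum.inl j) 1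

/-- Replace one factor `uⱼ` of the monomial with exponent `m` by `vⱼ`. -/
noncomputable def raiseExp (j : Fin n) (m : Fin n ⊕ Fin n →₀ ℕ) : Fin n ⊕ Fin n →₀ ℕ :=
  m - Finsupp.single (Sum.inl j) 1 + Finsupp.single (Sum.inr j) 1

/-- The summand `uⱼ ∂/∂vⱼ` of `s`. -/
noncomputable def sPart (j : Fin n) :
    MvPolynomial (Fin n ⊕ Fin n) (ZMod 2) →ₗ[ZMod 2] MvPolynomial (Fin n ⊕ Fin n) (ZMod 2) :=
  ((X (Sum.inl j) : MvPolynomial (Fin n ⊕ Fin n) (ZMod 2)) •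
    pderiv (R := ZMod 2) (Sum.inr j : Fin n ⊕ Fin n)).toLinearMap

theorem sDer_eq_sum_sPart (c : MvPolynomial (Fin n ⊕ Fin n) (ZMod 2)) :
    sDer n c = ∑ j, sPart j c := by
  classical
  have coe_sum : ∀ c, (∑ j : Fin n, (X (Sum.inl j) : MvPolynomial (Fin n ⊕ Fin n) (ZMod 2)) •
      pderiv (R := ZMod 2) (Sum.inr j : Fin n ⊕ Fin n)) c = ∑ j, sPart j c := fun c => by
    rw [← Derivation.coeFnAddMonoidHom_apply, map_sum, Finset.sum_apply]
    rfl
  rw [← coe_sum]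
  refine Derivation.congr_fun (MvPolynomial.derivation_ext ?_) c
  intro x
  rw [coe_sum]
  rcases x with i | i <;> simp [sPart, Pi.single_apply, pderiv_X]

open Classical in
theorem sPart_monomial (j : Fin n) (m : Fin n ⊕ Fin n →₀ ℕ) :
    sPart j (monomial m 1) = if Odd (m (Sum.inr j)) then monomial (lowerExp j m) 1 else 0 := by
  have h : sPart j (monomial m 1) = monomial (lowerExp j m) ((m (Sum.inr j) : ℕ) : ZMod 2) := by
    simp [sPart, pderiv_monomial, lowerExp, X, monomial_mul, add_comm]
  rw [h]
  split_ifs with ho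
  · rw [(ZMod.natCast_eq_one_iff_odd).2 ho]
  · rw [(ZMod.natCast_eq_zero_iff_even).2 (Nat.not_odd_iff_even.1 ho), map_zero]

open Classical in
/-- A homotopy for the `i`-th factor of the Koszul complex: `uᵢᵃ vᵢᵇ ↦ uᵢᵃ⁻¹ vᵢᵇ⁺¹` when
`a ≥ 1` and `b` is even, and zero otherwise. -/
noncomputable def homotopyPart (i : Fin n) :
    MvPolynomial (Fin n ⊕ Fin n) (ZMod 2) →ₗ[ZMod 2] MvPolynomial (Fin n ⊕ Fin n) (ZMod 2) :=
  (basisMonomials (Fin n ⊕ Fin n) (ZMod 2)).constr (ZMod 2) fun m =>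
    if m (Sum.inl i) ≠ 0 ∧ Even (m (Sum.inr i)) then monomial (raiseExp i m) 1 else 0

open Classical in
theorem homotopyPart_monomial (i : Fin n) (m : Fin n ⊕ Fin n →₀ ℕ) :
    homotopyPart i (monomial m 1) =
      if m (Sum.inl i) ≠ 0 ∧ Even (m (Sum.inr i)) then monomial (raiseExp i m) 1 else 0 := by
  have := (basisMonomials (Fin n ⊕ Fin n) (ZMod 2)).constr_basis (ZMod 2) (fun m =>
    if m (Sum.inl i) ≠ 0 ∧ Even (m (Sum.inr i)) then
      (monomial (raiseExp i m) 1 : MvPolynomial (Fin n ⊕ Fin n) (ZMod 2)) else 0) m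
  rwa [coe_basisMonomials] at this

/-- The restriction of a polynomial to the monomials with exponents satisfying `p`. -/
noncomputable def restrictMonomials (p : (Fin n ⊕ Fin n →₀ ℕ) → Prop) [DecidablePred p] :
    MvPolynomial (Fin n ⊕ Fin n) (ZMod 2) →ₗ[ZMod 2] MvPolynomial (Fin n ⊕ Fin n) (ZMod 2) :=
  (basisMonomials (Fin n ⊕ Fin n) (ZMod 2)).constr (ZMod 2) fun m =>
    if p m then monomial m 1 else 0

theorem restrictMonomials_monomial (p : (Fin n ⊕ Fin n →₀ ℕ) → Prop) [DecidablePred p]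
    (m : Fin n ⊕ Fin n →₀ ℕ) :
    restrictMonomials p (monomial m 1) = if p m then monomial m 1 else 0 := by
  have := (basisMonomials (Fin n ⊕ Fin n) (ZMod 2)).constr_basis (ZMod 2) (fun m =>
    if p m then (monomial m 1 : MvPolynomial (Fin n ⊕ Fin n) (ZMod 2)) else 0) m
  rwa [coe_basisMonomials] at this

theorem linearMap_ext_monomial {M : Type*} [AddCommMonoid M] [Module (ZMod 2) M]
    {f g : MvPolynomial (Fin n ⊕ Fin n) (ZMod 2) →ₗ[ZMod 2] M}
    (h : ∀ m, f (monomial m 1) = g (monomial m 1)) : f = g :=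
  (basisMonomials (Fin n ⊕ Fin n) (ZMod 2)).ext fun m => by simpa using h m

theorem coeff_restrictMonomials (p : (Fin n ⊕ Fin n →₀ ℕ) → Prop) [DecidablePred p]
    (c : MvPolynomial (Fin n ⊕ Fin n) (ZMod 2)) (m : Fin n ⊕ Fin n →₀ ℕ) :
    coeff m (restrictMonomials p c) = if p m then coeff m c else 0 := by
  classical
  have h : lcoeff (ZMod 2) m ∘ₗ restrictMonomials p =
      if p m then lcoeff (ZMod 2) m else 0 := by
    apply linearMap_ext_monomial
    intro m'
    by_cases hm : m' = m
    · subst hm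
      by_cases hp : p m' <;> simp [restrictMonomials_monomial, hp]
    · by_cases hp : p m <;> by_cases hp' : p m' <;>
        simp [restrictMonomials_monomial, hp, hp', coeff_monomial, hm]
  have := LinearMap.congr_fun h c
  by_cases hp : p m <;> simpa [hp] using this

theorem sPart_homotopyPart_of_ne {i j : Fin n} (hij : j ≠ i)
    (c : MvPolynomial (Fin n ⊕ Fin n) (ZMod 2)) :
    sPart j (homotopyPart i c) = homotopyPart i (sPart j c) := by
  classical
  have h : sPart j ∘ₗ homotopyPart i = homotopyPart i ∘ₗ sPart j := by
    apply linearMap_ext_monomial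
    intro m
    have h1 : raiseExp i m (Sum.inr j) = m (Sum.inr j) := by
      simp [raiseExp, hij.symm]
    have h2 : lowerExp j m (Sum.inl i) = m (Sum.inl i) := by
      simp [lowerExp, hij]
    have h3 : lowerExp j m (Sum.inr i) = m (Sum.inr i) := by
      simp [lowerExp, hij]
    have h4 : lowerExp j (raiseExp i m) = raiseExp i (lowerExp j m) := by
      ext x
      rcases x with x | x <;>
        simp only [lowerExp, raiseExp, Finsupp.add_apply, Finsupp.tsub_apply,
          Finsupp.single_apply, Sum.inl.injEq, Sum.inr.injEq, reduceCtorEq, if_false] <;>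
        grind
    simp only [LinearMap.comp_apply, homotopyPart_monomial, sPart_monomial, apply_ite (sPart j),
      apply_ite (homotopyPart i), map_zero, h1, h2, h3, h4]
    split_ifs <;> rfl
  exact LinearMap.congr_fun h c

open Classical in
theorem sPart_homotopyPart_self (i : Fin n) (c : MvPolynomial (Fin n ⊕ Fin n) (ZMod 2)) :
    sPart i (homotopyPart i c) + homotopyPart i (sPart i c) =
      c + restrictMonomials (fun m => m (Sum.inl i) = 0 ∧ Even (m (Sum.inr i))) c := by
  have h : sPart i ∘ₗ homotopyPart i + homotopyPart i ∘ₗ sPart i = LinearMap.id +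
      restrictMonomials (fun m => m (Sum.inl i) = 0 ∧ Even (m (Sum.inr i))) := by
    apply linearMap_ext_monomial
    intro m
    have h1 : raiseExp i m (Sum.inr i) = m (Sum.inr i) + 1 := by
      simp [raiseExp]
    have h2 : lowerExp i m (Sum.inl i) = m (Sum.inl i) + 1 := by
      simp [lowerExp]
    have h3 : lowerExp i m (Sum.inr i) = m (Sum.inr i) - 1 := by
      simp [lowerExp]
    have h4 : m (Sum.inl i) ≠ 0 → lowerExp i (raiseExp i m) = m := by
      intro h
      ext x
      rcases x with x | x <;>
        simp only [lowerExp, raiseExp, Finsupp.add_apply, Finsupp.tsub_apply,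
          Finsupp.single_apply, Sum.inl.injEq, Sum.inr.injEq, reduceCtorEq, if_false] <;>
        grind
    have h5 : m (Sum.inr i) ≠ 0 → raiseExp i (lowerExp i m) = m := by
      intro h
      ext x
      rcases x with x | x <;>
        simp only [lowerExp, raiseExp, Finsupp.add_apply, Finsupp.tsub_apply,
          Finsupp.single_apply, Sum.inl.injEq, Sum.inr.injEq, reduceCtorEq, if_false] <;>
        grind
    simp only [LinearMap.comp_apply, LinearMap.add_apply, LinearMap.id_apply,
      homotopyPart_monomial, sPart_monomial, restrictMonomials_monomial, apply_ite (sPart i),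
      apply_ite (homotopyPart i), map_zero, h1, h2, h3]
    by_cases he : Even (m (Sum.inr i))
    · have ho : ¬ Odd (m (Sum.inr i)) := Nat.not_odd_iff_even.2 he
      by_cases hz : m (Sum.inl i) = 0
      · simp [he, hz, ho, CharTwo.add_self_eq_zero]
      · simp [he, hz, ho, he.add_one, h4 hz]
    · have ho : Odd (m (Sum.inr i)) := Nat.not_even_iff_odd.1 he
      have hz : m (Sum.inr i) ≠ 0 := by rintro h; simp [h] at he
      have hs : Even (m (Sum.inr i) - 1) := by
        obtain ⟨k, hk⟩ := ho
        exact ⟨k, by omega⟩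
      simp [he, ho, hs, h5 hz]
  exact LinearMap.congr_fun h c

open Classical in
theorem sDer_homotopyPart (i : Fin n) (c : MvPolynomial (Fin n ⊕ Fin n) (ZMod 2)) :
    sDer n (homotopyPart i c) + homotopyPart i (sDer n c) =
      c + restrictMonomials (fun m => m (Sum.inl i) = 0 ∧ Even (m (Sum.inr i))) c := by
  rw [sDer_eq_sum_sPart, sDer_eq_sum_sPart, map_sum, ← Finset.sum_add_distrib,
    Finset.sum_eq_single i, sPart_homotopyPart_self]
  · intro j _ hj
    rw [sPart_homotopyPart_of_ne hj, CharTwo.add_self_eq_zero]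
  · simp

theorem exists_even_exponents_of_sDer_eq_zero {c : MvPolynomial (Fin n ⊕ Fin n) (ZMod 2)}
    (hc : sDer n c = 0) (S : Finset (Fin n)) :
    ∃ y, ∀ m ∈ (c + sDer n y).support, ∀ i ∈ S, Even (m (Sum.inr i)) := by
  classical
  induction S using Finset.induction_on with
  | empty => exact ⟨0, by simp⟩
  | insert i S _ ih =>
    obtain ⟨y, hy⟩ := ih
    have hz : sDer n (c + sDer n y) = 0 := by rw [map_add, hc, sDer_sDer, add_zero]
    have h := sDer_homotopyPart i (c + sDer n y)
    rw [hz, map_zero, add_zero] at h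
    refine ⟨y + homotopyPart i (c + sDer n y), ?_⟩
    have h' : c + sDer n (y + homotopyPart i (c + sDer n y)) =
        restrictMonomials (fun m => m (Sum.inl i) = 0 ∧ Even (m (Sum.inr i)))
          (c + sDer n y) := by
      rw [map_add (sDer n) y, h, ← add_assoc, ← add_assoc, CharTwo.add_self_eq_zero, zero_add]
    rw [h']
    intro m hm j hj
    rw [mem_support_iff, coeff_restrictMonomials] at hm
    split_ifs at hm with hp
    · rcases Finset.mem_insert.1 hj with rfl | hj
      · exact hp.2
      · exact hy m (mem_support_iff.2 hm) j hj
    · exact absurd rfl hm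

end KoszulHomotopy

section ParityDecomposition

variable {n : ℕ}

theorem Asub_induction {p : Asub n → Prop} (uA : ∀ i, p (uA n i)) (v2A : ∀ i, p (v2A n i))
    (algebraMap : ∀ r, p (algebraMap (ZMod 2) (Asub n) r))
    (add : ∀ a b, p a → p b → p (a + b)) (mul : ∀ a b, p a → p b → p (a * b)) (a : Asub n) :
    p a := by
  obtain ⟨a, ha⟩ := a
  induction ha using Algebra.adjoin_induction with
  | mem x hx =>
    rcases hx with ⟨i, rfl⟩ | ⟨i, rfl⟩
    · exact uA i
    · exact v2A i
  | algebraMap r => exact algebraMap r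
  | add x y hx hy ihx ihy => exact add ⟨x, hx⟩ ⟨y, hy⟩ ihx ihy
  | mul x y hx hy ihx ihy => exact mul ⟨x, hx⟩ ⟨y, hy⟩ ihx ihy

/-- The set of indices at which the exponent of `v` in a monomial is odd. -/
noncomputable def oddSet (m : Fin n ⊕ Fin n →₀ ℕ) : Finset (Fin n) :=
  Finset.univ.filter fun i => Odd (m (Sum.inr i))

/-- The largest factor of a monomial which belongs to `A`. -/
noncomputable def evenPart (m : Fin n ⊕ Fin n →₀ ℕ) : Asub n :=
  ∏ i, (uA n i ^ m (Sum.inl i) * v2A n i ^ (m (Sum.inr i) / 2))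

/-- The monomial `v_T`. -/
noncomputable def vProd (T : Finset (Fin n)) : MvPolynomial (Fin n ⊕ Fin n) (ZMod 2) :=
  ∏ i ∈ T, X (Sum.inr i)

theorem monomial_eq_evenPart_smul (m : Fin n ⊕ Fin n →₀ ℕ) :
    (monomial m 1 : MvPolynomial (Fin n ⊕ Fin n) (ZMod 2)) =
      evenPart m • vProd (oddSet m) := by
  rw [monomial_eq, Finsupp.prod_fintype _ _ (by simp), Fintype.prod_sum_type,
    ← Finset.prod_mul_distrib, map_one, one_mul, Subalgebra.smul_def, vProd, oddSet,
    Finset.prod_filter, evenPart, smul_eq_mul, ← Subalgebra.coe_val, map_prod,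
    ← Finset.prod_mul_distrib]
  refine Finset.prod_congr rfl fun i _ => ?_
  simp only [Subalgebra.coe_val, uA, v2A, MulMemClass.coe_mul, SubmonoidClass.coe_pow]
  rw [mul_assoc, ← pow_mul]
  congr 1
  split_ifs with h
  · conv_lhs => rw [← Nat.two_mul_div_two_add_one_of_odd h, pow_succ]
  · rw [Nat.two_mul_div_two_of_even (Nat.not_odd_iff_even.1 h), mul_one]

theorem evenPart_single_inl_add (i : Fin n) (m : Fin n ⊕ Fin n →₀ ℕ) :
    evenPart (Finsupp.single (Sum.inl i) 1 + m) = uA n i * evenPart m := by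
  classical
  have h : ∀ j, uA n j ^ (Finsupp.single (Sum.inl i) 1 + m : Fin n ⊕ Fin n →₀ ℕ) (Sum.inl j) *
      v2A n j ^ ((Finsupp.single (Sum.inl i) 1 + m : Fin n ⊕ Fin n →₀ ℕ) (Sum.inr j) / 2) =
      (if i = j then uA n j else 1) * (uA n j ^ m (Sum.inl j) * v2A n j ^ (m (Sum.inr j) / 2)) := by
    intro j
    by_cases hj : i = j
    · simp [hj, pow_add, mul_assoc]
    · simp [hj]
  rw [evenPart, Finset.prod_congr rfl fun j _ => h j, Finset.prod_mul_distrib]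
  simp [evenPart]

theorem evenPart_single_inr_add (i : Fin n) (m : Fin n ⊕ Fin n →₀ ℕ) :
    evenPart (Finsupp.single (Sum.inr i) 2 + m) = v2A n i * evenPart m := by
  classical
  have h : ∀ j, uA n j ^ (Finsupp.single (Sum.inr i) 2 + m : Fin n ⊕ Fin n →₀ ℕ) (Sum.inl j) *
      v2A n j ^ ((Finsupp.single (Sum.inr i) 2 + m : Fin n ⊕ Fin n →₀ ℕ) (Sum.inr j) / 2) =
      (if i = j then v2A n j else 1) *
        (uA n j ^ m (Sum.inl j) * v2A n j ^ (m (Sum.inr j) / 2)) := by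
    intro j
    by_cases hj : i = j
    · have : (2 + m (Sum.inr j)) / 2 = 1 + m (Sum.inr j) / 2 := by omega
      simp [hj, this, pow_add, mul_left_comm]
    · simp [hj]
  rw [evenPart, Finset.prod_congr rfl fun j _ => h j, Finset.prod_mul_distrib]
  simp [evenPart]

theorem oddSet_single_inl_add (i : Fin n) (m : Fin n ⊕ Fin n →₀ ℕ) :
    oddSet (Finsupp.single (Sum.inl i) 1 + m) = oddSet m := by
  simp [oddSet]

theorem oddSet_single_inr_add (i : Fin n) (m : Fin n ⊕ Fin n →₀ ℕ) :
    oddSet (Finsupp.single (Sum.inr i) 2 + m) = oddSet m := by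
  classical
  ext j
  by_cases hj : i = j <;> simp [oddSet, hj, Nat.odd_add, Nat.not_odd_iff_even.2 even_two]

variable {M : Type*} [AddCommGroup M] [Module (Asub n) M] [Module (ZMod 2) M]

/-- The `k`-linear map sending a monomial `a v_T`, with `a ∈ A`, to `a w_T`. -/
noncomputable def parityLiftAux (w : Finset (Fin n) → M) :
    MvPolynomial (Fin n ⊕ Fin n) (ZMod 2) →ₗ[ZMod 2] M :=
  (basisMonomials (Fin n ⊕ Fin n) (ZMod 2)).constr (ZMod 2) fun m => evenPart m • w (oddSet m)

theorem parityLiftAux_monomial (w : Finset (Fin n) → M) (m : Fin n ⊕ Fin n →₀ ℕ) :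
    parityLiftAux w (monomial m 1) = evenPart m • w (oddSet m) := by
  have := (basisMonomials (Fin n ⊕ Fin n) (ZMod 2)).constr_basis (ZMod 2)
    (fun m => evenPart m • w (oddSet m)) m
  rwa [coe_basisMonomials] at this

theorem parityLiftAux_smul [IsScalarTower (ZMod 2) (Asub n) M] (w : Finset (Fin n) → M)
    (a : Asub n) (c : MvPolynomial (Fin n ⊕ Fin n) (ZMod 2)) :
    parityLiftAux w (a • c) = a • parityLiftAux w c := by
  have : SMulCommClass (ZMod 2) (Asub n) M := IsScalarTower.to_smulCommClass
  induction a using Asub_induction generalizing c with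
  | uA i =>
    have h : parityLiftAux w ∘ₗ LinearMap.mulLeft (ZMod 2) (X (Sum.inl i)) =
        ((LinearMap.lsmul (Asub n) M (uA n i)).restrictScalars (ZMod 2)).comp
          (parityLiftAux w) := by
      apply linearMap_ext_monomial
      intro m
      simp only [LinearMap.comp_apply, LinearMap.mulLeft_apply, X, monomial_mul, one_mul,
        parityLiftAux_monomial, evenPart_single_inl_add, oddSet_single_inl_add, mul_smul,
        LinearMap.restrictScalars_apply, LinearMap.lsmul_apply]
    exact LinearMap.congr_fun h c
  | v2A i =>
    have h : parityLiftAux w ∘ₗ LinearMap.mulLeft (ZMod 2) (X (Sum.inr i) ^ 2) =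
        ((LinearMap.lsmul (Asub n) M (v2A n i)).restrictScalars (ZMod 2)).comp
          (parityLiftAux w) := by
      apply linearMap_ext_monomial
      intro m
      simp only [LinearMap.comp_apply, LinearMap.mulLeft_apply, X_pow_eq_monomial, monomial_mul,
        one_mul, parityLiftAux_monomial, evenPart_single_inr_add, oddSet_single_inr_add, mul_smul,
        LinearMap.restrictScalars_apply, LinearMap.lsmul_apply]
    exact LinearMap.congr_fun h c
  | algebraMap r => rw [algebraMap_smul, algebraMap_smul, map_smul]
  | add x y ihx ihy => rw [add_smul, add_smul, map_add, ihx, ihy]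
  | mul x y ihx ihy => rw [mul_smul, mul_smul, ihx, ihy]

/-- The `A`-linear map on `C` sending each `v_T` to `w_T`. -/
noncomputable def parityLift [IsScalarTower (ZMod 2) (Asub n) M] (w : Finset (Fin n) → M) :
    MvPolynomial (Fin n ⊕ Fin n) (ZMod 2) →ₗ[Asub n] M where
  __ := parityLiftAux w
  map_smul' := parityLiftAux_smul w

@[simp] theorem parityLift_vProd [IsScalarTower (ZMod 2) (Asub n) M] (w : Finset (Fin n) → M)
    (T : Finset (Fin n)) : parityLift w (vProd T) = w T := by
  classical
  have h : (vProd T : MvPolynomial (Fin n ⊕ Fin n) (ZMod 2)) =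
      monomial (∑ i ∈ T, Finsupp.single (Sum.inr i) 1) 1 := by
    rw [vProd, monomial_sum_one]; rfl
  have hl : ∀ j, (∑ i ∈ T, Finsupp.single (Sum.inr i) 1 : Fin n ⊕ Fin n →₀ ℕ) (Sum.inl j) = 0 := by
    simp [Finsupp.finsetSum_apply]
  have hr : ∀ j, (∑ i ∈ T, Finsupp.single (Sum.inr i) 1 : Fin n ⊕ Fin n →₀ ℕ) (Sum.inr j) =
      if j ∈ T then 1 else 0 := by
    simp [Finsupp.finsetSum_apply, Finsupp.single_apply]
  have he : evenPart (∑ i ∈ T, Finsupp.single (Sum.inr i) 1 : Fin n ⊕ Fin n →₀ ℕ) = 1 := by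
    refine Finset.prod_eq_one fun j _ => ?_
    rw [hl, hr]
    split_ifs <;> simp
  have ho : oddSet (∑ i ∈ T, Finsupp.single (Sum.inr i) 1 : Fin n ⊕ Fin n →₀ ℕ) = T := by
    ext j
    simp only [oddSet, Finset.mem_filter_univ, hr]
    split_ifs with hj <;> simp [hj]
  change parityLiftAux w (vProd T) = w T
  rw [h, parityLiftAux_monomial, he, ho, one_smul]

theorem induction_on_vProd {p : MvPolynomial (Fin n ⊕ Fin n) (ZMod 2) → Prop}
    (c : MvPolynomial (Fin n ⊕ Fin n) (ZMod 2)) (vProd : ∀ T, p (vProd T))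
    (smul : ∀ (a : Asub n) c, p c → p (a • c)) (add : ∀ c d, p c → p d → p (c + d)) : p c := by
  induction c using MvPolynomial.induction_on' with
  | monomial m r =>
    have : (monomial m r : MvPolynomial (Fin n ⊕ Fin n) (ZMod 2)) =
        algebraMap (ZMod 2) (Asub n) r • monomial m 1 := by
      rw [algebraMap_smul, smul_monomial, smul_eq_mul, mul_one]
    rw [this, monomial_eq_evenPart_smul]
    exact smul _ _ (smul _ _ (vProd _))
  | add c d hc hd => exact add c d hc hd

theorem linearMap_ext_vProd {M : Type*} [AddCommGroup M] [Module (Asub n) M]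
    {f g : MvPolynomial (Fin n ⊕ Fin n) (ZMod 2) →ₗ[Asub n] M}
    (h : ∀ T, f (vProd T) = g (vProd T)) : f = g := by
  ext1 c
  induction c using induction_on_vProd with
  | vProd T => exact h T
  | smul a c hc => rw [map_smul, map_smul, hc]
  | add c d hc hd => rw [map_add, map_add, hc, hd]

theorem mem_Asub_of_even_exponents {c : MvPolynomial (Fin n ⊕ Fin n) (ZMod 2)}
    (h : ∀ m ∈ c.support, ∀ i, Even (m (Sum.inr i))) : c ∈ Asub n := by
  rw [c.as_sum]
  refine sum_mem fun m hm => ?_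
  have ho : oddSet m = ∅ := by
    ext i
    simpa [oddSet] using h m hm i
  have : (monomial m (coeff m c) : MvPolynomial (Fin n ⊕ Fin n) (ZMod 2)) =
      coeff m c • monomial m 1 := by
    rw [smul_monomial, smul_eq_mul, mul_one]
  rw [this, monomial_eq_evenPart_smul, ho, vProd, Finset.prod_empty, Subalgebra.smul_def,
    smul_eq_mul, mul_one]
  exact Subalgebra.smul_mem _ (evenPart m).2 _

/-- Every cycle of `s` is an element of `A` up to a boundary. -/
theorem exists_add_sDer_mem_Asub {c : MvPolynomial (Fin n ⊕ Fin n) (ZMod 2)}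
    (hc : sDer n c = 0) : ∃ y, c + sDer n y ∈ Asub n := by
  obtain ⟨y, hy⟩ := exists_even_exponents_of_sDer_eq_zero hc Finset.univ
  exact ⟨y, mem_Asub_of_even_exponents fun m hm i => hy m hm i (Finset.mem_univ i)⟩

theorem sDer_eq_zero_of_mem_Asub {a : MvPolynomial (Fin n ⊕ Fin n) (ZMod 2)}
    (ha : a ∈ Asub n) : sDer n a = 0 := by
  induction ha using Algebra.adjoin_induction with
  | mem x hx =>
    rcases hx with ⟨i, rfl⟩ | ⟨i, rfl⟩
    · exact sDer_inl i
    · simp only [pow_two]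
      rw [Derivation.leibniz, CharTwo.add_self_eq_zero]
  | algebraMap r => exact (sDer n).map_algebraMap r
  | add x y _ _ hx hy => rw [map_add, hx, hy, add_zero]
  | mul x y _ _ hx hy => rw [Derivation.leibniz, hx, hy, smul_zero, smul_zero, add_zero]

/-- `s` as an `A`-linear map. -/
noncomputable def sLin (n : ℕ) : MvPolynomial (Fin n ⊕ Fin n) (ZMod 2) →ₗ[Asub n]
    MvPolynomial (Fin n ⊕ Fin n) (ZMod 2) where
  toFun := sDer n
  map_add' := map_add _
  map_smul' a c := by
    simp [Subalgebra.smul_def, Derivation.leibniz, sDer_eq_zero_of_mem_Asub a.2]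

theorem sDer_vProd (T : Finset (Fin n)) :
    sDer n (vProd T) = ∑ i ∈ T, uA n i • vProd (T.erase i) := by
  classical
  induction T using Finset.induction_on with
  | empty => simp [vProd]
  | insert j T hj ih =>
    rw [Finset.sum_insert hj, Finset.erase_insert hj]
    have h : ∀ S : Finset (Fin n), j ∉ S → vProd (insert j S) = X (Sum.inr j) * vProd S :=
      fun S hS => Finset.prod_insert hS
    have h' : ∀ i ∈ T, uA n i • vProd ((insert j T).erase i) =
        X (Sum.inr j) * uA n i • vProd (T.erase i) := fun i hi => by
      rw [Finset.erase_insert_of_ne (by rintro rfl; exact hj hi),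
        h _ fun h => hj (Finset.mem_of_mem_erase h), mul_smul_comm]
    rw [Finset.sum_congr rfl h', ← Finset.mul_sum, ← ih, h T hj, Derivation.leibniz, sDer_inr,
      add_comm, smul_eq_mul, smul_eq_mul, Subalgebra.smul_def, smul_eq_mul, mul_comm (vProd T)]
    rfl

theorem vProd_mul_vProd (T U : Finset (Fin n)) :
    vProd T * vProd U = (∏ r ∈ T ∩ U, v2A n r) • vProd (symmDiff T U) := by
  classical
  have h : ((∏ r ∈ T ∩ U, v2A n r : Asub n) : MvPolynomial (Fin n ⊕ Fin n) (ZMod 2)) =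
      vProd (T ∩ U) * vProd (T ∩ U) := by
    rw [← Subalgebra.coe_val, map_prod, vProd, ← Finset.prod_mul_distrib]
    exact Finset.prod_congr rfl fun r _ => pow_two _
  have hT : vProd T = vProd (T ∩ U) * vProd (T \ U) := by
    rw [mul_comm, vProd, vProd, vProd, ← Finset.prod_union, Finset.sdiff_union_inter]
    exact Finset.disjoint_sdiff_inter T U
  have hU : vProd U = vProd (T ∩ U) * vProd (U \ T) := by
    rw [mul_comm, Finset.inter_comm, vProd, vProd, vProd, ← Finset.prod_union,
      Finset.sdiff_union_inter]
    exact Finset.disjoint_sdiff_inter U T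
  have hS : vProd (symmDiff T U) = vProd (T \ U) * vProd (U \ T) := by
    rw [symmDiff_def, Finset.sup_eq_union, vProd, Finset.prod_union]
    · rfl
    · exact disjoint_sdiff_sdiff
  rw [Subalgebra.smul_def, h, hT, hU, hS, smul_eq_mul]
  ring

/-- The product formula for the boundaries `s(v_T)`. -/
theorem sDer_vProd_mul_sDer_vProd (T U : Finset (Fin n)) :
    sDer n (vProd T) * sDer n (vProd U) = ∑ q ∈ T,
      (uA n q * ∏ r ∈ (T ∩ U).erase q, v2A n r) • sDer n (vProd (symmDiff (T.erase q) U)) := by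
  classical
  have h : sDer n (vProd T) * sDer n (vProd U) = sLin n (sDer n (vProd T) * vProd U) := by
    change _ = sDer n _
    rw [Derivation.leibniz, sDer_sDer, smul_zero, add_zero, smul_eq_mul]
  rw [h, sDer_vProd T, Finset.sum_mul, map_sum]
  refine Finset.sum_congr rfl fun q _ => ?_
  rw [smul_mul_assoc, vProd_mul_vProd, smul_smul, map_smul, Finset.erase_inter]
  rfl

end ParityDecomposition

section Presentation

variable {n : ℕ}

/-- The `A`-linear map `C → A[c_T]` with `v_T ↦ c_T`. -/
noncomputable def psiMap (n : ℕ) :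
    MvPolynomial (Fin n ⊕ Fin n) (ZMod 2) →ₗ[Asub n] MvPolynomial (cIdx n) (Asub n) :=
  parityLift (cOf n)

@[simp] theorem psiMap_vProd (T : Finset (Fin n)) : psiMap n (vProd T) = cOf n T :=
  parityLift_vProd _ _

/-- The `A`-linear projection `C → A` onto the coordinate of `v_∅ = 1`. -/
noncomputable def constCoord (n : ℕ) :
    MvPolynomial (Fin n ⊕ Fin n) (ZMod 2) →ₗ[Asub n] Asub n :=
  parityLift fun T => if T.card = 0 then 1 else 0

theorem constCoord_vProd (T : Finset (Fin n)) :
    constCoord n (vProd T) = if T.card = 0 then 1 else 0 :=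
  parityLift_vProd _ _

theorem coe_eq_smul_vProd_empty (a : Asub n) :
    (a : MvPolynomial (Fin n ⊕ Fin n) (ZMod 2)) = a • vProd ∅ := by
  rw [vProd, Finset.prod_empty, Subalgebra.smul_def, smul_eq_mul, mul_one]

theorem constCoord_coe (a : Asub n) :
    constCoord n (a : MvPolynomial (Fin n ⊕ Fin n) (ZMod 2)) = a := by
  rw [coe_eq_smul_vProd_empty, map_smul, constCoord_vProd]
  simp

theorem cOf_empty : cOf n ∅ = 0 := by simp [cOf]

theorem cOf_singleton (j : Fin n) : cOf n {j} = C (uA n j) := by simp [cOf]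

theorem psiMap_coe (a : Asub n) :
    psiMap n (a : MvPolynomial (Fin n ⊕ Fin n) (ZMod 2)) = 0 := by
  rw [coe_eq_smul_vProd_empty, map_smul, psiMap_vProd, cOf_empty, smul_zero]

theorem phiMap_C (a : Asub n) :
    phiMap n (C a) = (a : MvPolynomial (Fin n ⊕ Fin n) (ZMod 2)) :=
  (phiMap n).commutes a

theorem phiMap_cOf (T : Finset (Fin n)) : phiMap n (cOf n T) = sDer n (vProd T) := by
  rw [cOf]
  split_ifs with h
  · rw [phiMap, aeval_X]
    rfl
  · rw [phiMap_C, sDer_vProd]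
    have : T.card = 0 ∨ T.card = 1 := by omega
    rcases this with h | h
    · rw [Finset.card_eq_zero.1 h]
      simp
    · obtain ⟨j, rfl⟩ := Finset.card_eq_one.1 h
      simp [vProd, Subalgebra.smul_def]

theorem phiMap_psiMap (x : MvPolynomial (Fin n ⊕ Fin n) (ZMod 2)) :
    phiMap n (psiMap n x) = sDer n x := by
  have h : (phiMap n).toLinearMap ∘ₗ psiMap n = sLin n := by
    apply linearMap_ext_vProd
    intro T
    simp only [LinearMap.comp_apply, AlgHom.toLinearMap_apply, psiMap_vProd, phiMap_cOf]
    rfl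
  exact LinearMap.congr_fun h x

theorem Asub_add_self (a : Asub n) : a + a = 0 :=
  Subtype.ext (CharTwo.add_self_eq_zero (a : MvPolynomial (Fin n ⊕ Fin n) (ZMod 2)))

theorem add_self_eq_zero_of_Asub (p : MvPolynomial (cIdx n) (Asub n)) : p + p = 0 := by
  rw [← one_mul p, ← add_mul, ← C_1, ← C_add, Asub_add_self, C_0, zero_mul]

theorem sDer_phiMap (f : MvPolynomial (cIdx n) (Asub n)) : sDer n (phiMap n f) = 0 := by
  induction f using MvPolynomial.induction_on with
  | C a => rw [phiMap_C, sDer_eq_zero_of_mem_Asub a.2]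
  | add f g hf hg => rw [map_add, map_add, hf, hg, add_zero]
  | mul_X f T hf =>
    rw [map_mul, Derivation.leibniz, hf, phiMap, aeval_X, sDer_sDer, smul_zero, smul_zero,
      add_zero]

theorem sDer_vProd_pair {i j : Fin n} (hij : i ≠ j) :
    sDer n (vProd {i, j}) = X (Sum.inl i) * X (Sum.inr j) + X (Sum.inl j) * X (Sum.inr i) := by
  rw [vProd, Finset.prod_pair hij, Derivation.leibniz, sDer_inr, sDer_inr, smul_eq_mul,
    smul_eq_mul]
  ring

theorem Nideal_le_ker : Nideal n ≤ RingHom.ker (phiMap n :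
    MvPolynomial (cIdx n) (Asub n) →+* MvPolynomial (Fin n ⊕ Fin n) (ZMod 2)) := by
  rw [Nideal, Ideal.span_le]
  rintro p ((⟨T, -, rfl⟩ | ⟨i, j, hij, rfl⟩) | ⟨T, U, -, -, -, rfl⟩) <;>
    simp only [SetLike.mem_coe, RingHom.mem_ker, RingHom.coe_coe]
  · have h : ∀ i ∈ T, phiMap n (C (uA n i) * cOf n (T.erase i)) =
        sLin n (uA n i • vProd (T.erase i)) := fun i _ => by
      rw [map_mul, phiMap_C, phiMap_cOf, map_smul]
      rfl
    rw [map_sum, Finset.sum_congr rfl h, ← map_sum, ← sDer_vProd]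
    exact sDer_sDer _
  · rw [map_add, map_pow, phiMap_cOf, phiMap_C, sDer_vProd_pair hij, CharTwo.add_sq]
    simp only [uA, v2A, MulMemClass.coe_mul, SubmonoidClass.coe_pow, AddMemClass.coe_add]
    rw [mul_pow, mul_pow, CharTwo.add_self_eq_zero]
  · have h : ∀ q ∈ T, phiMap n (C (uA n q * ∏ r ∈ (T ∩ U).erase q, v2A n r) *
        cOf n (symmDiff (T.erase q) U)) =
        (uA n q * ∏ r ∈ (T ∩ U).erase q, v2A n r) • sDer n (vProd (symmDiff (T.erase q) U)) :=
      fun i _ => by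
        rw [map_mul, phiMap_C, phiMap_cOf]
        rfl
    rw [map_add, map_mul, map_sum, Finset.sum_congr rfl h, phiMap_cOf, phiMap_cOf,
      sDer_vProd_mul_sDer_vProd, CharTwo.add_self_eq_zero]

theorem smul_mem_Nideal (a : Asub n) {p : MvPolynomial (cIdx n) (Asub n)} (hp : p ∈ Nideal n) :
    a • p ∈ Nideal n := by
  rw [smul_eq_C_mul]
  exact Ideal.mul_mem_left _ _ hp

theorem psiMap_sDer_mem (x : MvPolynomial (Fin n ⊕ Fin n) (ZMod 2)) :
    psiMap n (sDer n x) ∈ Nideal n := by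
  induction x using induction_on_vProd with
  | vProd T =>
    rw [sDer_vProd, map_sum]
    simp only [map_smul, psiMap_vProd, smul_eq_C_mul]
    by_cases hT : 3 ≤ T.card
    · exact Ideal.subset_span (Or.inl (Or.inl ⟨T, hT, rfl⟩))
    · have h0 : ∑ i ∈ T, C (uA n i) * cOf n (T.erase i) = 0 := by
        have : T.card = 0 ∨ T.card = 1 ∨ T.card = 2 := by omega
        rcases this with h | h | h
        · rw [Finset.card_eq_zero.1 h, Finset.sum_empty]
        · obtain ⟨j, rfl⟩ := Finset.card_eq_one.1 h
          simp [cOf_empty]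
        · obtain ⟨i, j, hij, rfl⟩ := Finset.card_eq_two.1 h
          have h1 : ({i, j} : Finset (Fin n)).erase i = {j} := by
            rw [Finset.erase_insert (by simpa using hij)]
          have h2 : ({i, j} : Finset (Fin n)).erase j = {i} := by
            rw [Finset.pair_comm, Finset.erase_insert (by simpa using hij.symm)]
          rw [Finset.sum_pair hij, h1, h2, cOf_singleton, cOf_singleton, mul_comm, ← C_mul,
            ← C_add, Asub_add_self, C_0]
      rw [h0]
      exact zero_mem _
  | smul a c hc =>
    change psiMap n (sLin n (a • c)) ∈ _
    rw [map_smul, map_smul]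
    exact smul_mem_Nideal a hc
  | add c d hc hd =>
    rw [map_add, map_add]
    exact add_mem hc hd

theorem psiMap_mem_of_sDer_eq_zero {x : MvPolynomial (Fin n ⊕ Fin n) (ZMod 2)}
    (hx : sDer n x = 0) : psiMap n x ∈ Nideal n := by
  obtain ⟨y, hy⟩ := exists_add_sDer_mem_Asub hx
  have h : psiMap n x + psiMap n (sDer n y) = 0 := by
    rw [← map_add]
    exact psiMap_coe ⟨_, hy⟩
  rw [← add_zero (psiMap n x), ← add_self_eq_zero_of_Asub (psiMap n (sDer n y)), ← add_assoc, h,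
    zero_add]
  exact psiMap_sDer_mem y

/-- The `A`-submodule of `A[c_T]` spanned by `1` and the variables. -/
noncomputable def linearPart (n : ℕ) : Submodule (Asub n) (MvPolynomial (cIdx n) (Asub n)) :=
  Submodule.span (Asub n) ({1} ∪ Set.range X)

theorem C_mem_linearPart (a : Asub n) : C a ∈ linearPart n := by
  rw [← mul_one (C a), ← smul_eq_C_mul]
  exact Submodule.smul_mem _ _ (Submodule.subset_span (Or.inl rfl))

theorem cOf_mem_linearPart (S : Finset (Fin n)) : cOf n S ∈ linearPart n := by
  rw [cOf]
  split_ifs with h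
  · exact Submodule.subset_span (Or.inr ⟨_, rfl⟩)
  · exact C_mem_linearPart _

theorem X_mul_X_mem (T U : cIdx n) :
    (X T * X U : MvPolynomial (cIdx n) (Asub n)) ∈
      linearPart n ⊔ (Nideal n).restrictScalars (Asub n) := by
  have hX : ∀ T : cIdx n, (X T : MvPolynomial (cIdx n) (Asub n)) = cOf n T.1 := fun T => by
    rw [cOf, dif_pos T.2]
  rw [hX, hX]
  have key : ∀ p q : MvPolynomial (cIdx n) (Asub n), q ∈ linearPart n → p + q ∈ Nideal n →
      p ∈ linearPart n ⊔ (Nideal n).restrictScalars (Asub n) := fun p q hq hpq => by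
    rw [← add_zero p, ← add_self_eq_zero_of_Asub q, ← add_assoc]
    exact add_mem (Submodule.mem_sup_right hpq) (Submodule.mem_sup_left hq)
  by_cases h : T.1.card = 2 ∧ T.1 = U.1
  · obtain ⟨i, j, hij, hT⟩ := Finset.card_eq_two.1 h.1
    rw [← h.2, hT, ← pow_two]
    exact key _ _ (C_mem_linearPart _) (Ideal.subset_span (Or.inl (Or.inr ⟨i, j, hij, rfl⟩)))
  · refine key _ _ (sum_mem fun q _ => ?_) (Ideal.subset_span
      (Or.inr ⟨T.1, U.1, T.2, U.2, fun h1 _ h2 => h ⟨h1, h2⟩, rfl⟩))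
    rw [← smul_eq_C_mul]
    exact Submodule.smul_mem _ _ (cOf_mem_linearPart _)

theorem linearPart_sup_Nideal :
    linearPart n ⊔ (Nideal n).restrictScalars (Asub n) = ⊤ := by
  rw [eq_top_iff]
  rintro f -
  induction f using MvPolynomial.induction_on with
  | C a => exact Submodule.mem_sup_left (C_mem_linearPart a)
  | add f g hf hg => exact add_mem hf hg
  | mul_X f T hf =>
    have h : linearPart n ⊔ (Nideal n).restrictScalars (Asub n) ≤
        (linearPart n ⊔ (Nideal n).restrictScalars (Asub n)).comap
          (LinearMap.mulRight (Asub n) (X T)) := by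
      refine sup_le (Submodule.span_le.2 ?_) fun p hp => ?_
      · rintro _ (rfl | ⟨U, rfl⟩)
        · simp only [SetLike.mem_coe, Submodule.mem_comap, LinearMap.mulRight_apply, one_mul]
          exact Submodule.mem_sup_left (Submodule.subset_span (Or.inr ⟨T, rfl⟩))
        · exact X_mul_X_mem U T
      · exact Submodule.mem_sup_right (Ideal.mul_mem_right _ (Nideal n) hp)
    exact h hf

theorem exists_eq_C_add_psiMap {f : MvPolynomial (cIdx n) (Asub n)} (hf : f ∈ linearPart n) :
    ∃ a x, constCoord n (sDer n x) = 0 ∧ f = C a + psiMap n x := by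
  induction hf using Submodule.span_induction with
  | mem f hf =>
    rcases hf with rfl | ⟨T, rfl⟩
    · exact ⟨1, 0, by simp, by simp⟩
    · refine ⟨0, vProd T.1, ?_, by rw [psiMap_vProd, C_0, zero_add, cOf, dif_pos T.2]⟩
      rw [sDer_vProd, map_sum]
      refine Finset.sum_eq_zero fun i hi => ?_
      have := T.2
      rw [map_smul, constCoord_vProd, if_neg, smul_zero]
      rw [Finset.card_erase_of_mem hi]
      omega
  | zero => exact ⟨0, 0, by simp, by simp⟩
  | add f g _ _ hf hg =>
    obtain ⟨a, x, hx, rfl⟩ := hf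
    obtain ⟨b, y, hy, rfl⟩ := hg
    exact ⟨a + b, x + y, by simp [hx, hy], by rw [C_add, map_add]; ring⟩
  | smul r f _ hf =>
    obtain ⟨a, x, hx, rfl⟩ := hf
    refine ⟨r * a, r • x, ?_, ?_⟩
    · change constCoord n (sLin n (r • x)) = 0
      rw [map_smul, map_smul]
      exact (congrArg (r • ·) hx).trans (smul_zero r)
    · rw [smul_add, map_smul, smul_eq_C_mul, C_mul]

theorem ker_phiMap_le : RingHom.ker (phiMap n :
    MvPolynomial (cIdx n) (Asub n) →+* MvPolynomial (Fin n ⊕ Fin n) (ZMod 2)) ≤ Nideal n := by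
  intro f hf
  obtain ⟨g, hg, p, hp, rfl⟩ := Submodule.mem_sup.1
    (linearPart_sup_Nideal (n := n) ▸ Submodule.mem_top : f ∈ linearPart n ⊔ _)
  obtain ⟨a, x, hx, rfl⟩ := exists_eq_C_add_psiMap hg
  have hp0 : phiMap n p = 0 := Nideal_le_ker hp
  have h0 : phiMap n (C a + psiMap n x + p) = 0 := hf
  rw [map_add, hp0, add_zero, map_add, phiMap_C, phiMap_psiMap] at h0
  have ha : a = 0 := by
    simpa [constCoord_coe, hx] using congrArg (constCoord n) h0
  subst ha
  rw [ZeroMemClass.coe_zero, zero_add] at h0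
  rw [C_0, zero_add]
  exact add_mem (psiMap_mem_of_sDer_eq_zero h0) hp

theorem mem_range_phiMap_of_sDer_eq_zero {c : MvPolynomial (Fin n ⊕ Fin n) (ZMod 2)}
    (hc : sDer n c = 0) : c ∈ (phiMap n).range := by
  obtain ⟨y, hy⟩ := exists_add_sDer_mem_Asub hc
  refine ⟨C ⟨_, hy⟩ - psiMap n y, ?_⟩
  change phiMap n _ = c
  rw [map_sub, phiMap_C, phiMap_psiMap, add_sub_cancel_right]

end Presentation

/-- The induced `A`-algebra map `A[c_T]/N → B = ker(s)`, `c_T ↦ s(v_T)`, is an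
isomorphism: i.e. `ker(φ) = N` and the image of `φ` is exactly `ker(s)`. -/
theorem stmt11 (n : ℕ) :
    RingHom.ker (phiMap n :
        MvPolynomial (cIdx n) (Asub n) →+* MvPolynomial (Fin n ⊕ Fin n) (ZMod 2)) =
      Nideal n ∧
    ∀ c : MvPolynomial (Fin n ⊕ Fin n) (ZMod 2),
      sDer n c = 0 ↔ c ∈ (phiMap n).range := by
  refine ⟨le_antisymm ker_phiMap_le Nideal_le_ker, fun c => ⟨mem_range_phiMap_of_sDer_eq_zero, ?_⟩⟩
  rintro ⟨f, rfl⟩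
  exact sDer_phiMap f
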